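/- arXiv:1701.05298 — 3 statements merged into one kernel-verified Lean document; each statement's English description precedes it below -/
import Mathlib

section
/- Let (E, ∘, ⟨·,·⟩) be a Euclidean Jordan algebra with symmetric cone K, and let y ∈ E have spectral decomposition y = Σ_{i=1}^r σ_i c_i with respect to a Jordan frame c_1, …, c_r. Then the point Σ_{i=1}^r max(σ_i, 0) c_i belongs to K and is the unique minimizer of ‖y − z‖ over z ∈ K; that is, the metric projection of y onto K is obtained by zeroing the negative eigenvalues of y. -/
open scoped RealInnerProductSpace

noncomputable section

/-- A Euclidean Jordan algebra structure on a finite-dimensional real inner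
product space `E`: a commutative bilinear product `jmul` with unit, satisfying
the Jordan identity and compatibility with the inner product, together with the
spectral theorem (every element has a spectral decomposition along a Jordan
frame of size `rank`) and the normalization `⟪c, c⟫ = 1` for primitive
idempotents, which encodes that the inner product is the trace form. -/
structure EJA (E : Type*) [NormedAddCommGroup E] [InnerProductSpace ℝ E]
    [FiniteDimensional ℝ E] where
  jmul : E →ₗ[ℝ] E →ₗ[ℝ] E
  comm : ∀ y z : E, jmul y z = jmul z y
  unit : E
  unit_jmul : ∀ y : E, jmul unit y = y
  jordan : ∀ y z : E, jmul y (jmul (jmul y y) z) = jmul (jmul y y) (jmul y z)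
  assoc_inner : ∀ y z w : E, ⟪jmul y z, w⟫ = ⟪y, jmul z w⟫
  rank : ℕ
  spectral : ∀ y : E, ∃ (c : Fin rank → E) (σ : Fin rank → ℝ),
    (∀ i, jmul (c i) (c i) = c i) ∧
    (∀ i, c i ≠ 0) ∧
    (∀ i, ∀ a b : E, jmul a a = a → jmul b b = b → a ≠ 0 → b ≠ 0 →
      jmul a b = 0 → c i ≠ a + b) ∧
    (∀ i j, i ≠ j → jmul (c i) (c j) = 0) ∧
    (∑ i, c i) = unit ∧
    y = ∑ i, σ i • c i
  inner_primitive : ∀ c : E, jmul c c = c → c ≠ 0 →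
    (∀ a b : E, jmul a a = a → jmul b b = b → a ≠ 0 → b ≠ 0 →
      jmul a b = 0 → c ≠ a + b) →
    ⟪c, c⟫ = 1

namespace EJA

variable {E : Type*} [NormedAddCommGroup E] [InnerProductSpace ℝ E]
  [FiniteDimensional ℝ E]

/-- `c` is an idempotent. -/
def IsIdempotent (J : EJA E) (c : E) : Prop := J.jmul c c = c

/-- `c` is a primitive idempotent. -/
def IsPrimitive (J : EJA E) (c : E) : Prop :=
  J.IsIdempotent c ∧ c ≠ 0 ∧
    ∀ a b : E, J.IsIdempotent a → J.IsIdempotent b → a ≠ 0 → b ≠ 0 →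
      J.jmul a b = 0 → c ≠ a + b

/-- A Jordan frame: primitive idempotents, pairwise orthogonal (w.r.t. the
Jordan product), summing to the unit. -/
def IsJordanFrame (J : EJA E) (c : Fin J.rank → E) : Prop :=
  (∀ i, J.IsPrimitive (c i)) ∧ (∀ i j, i ≠ j → J.jmul (c i) (c j) = 0) ∧
    (∑ i, c i) = J.unit

/-- The symmetric cone: the cone of squares of the algebra. -/
def K (J : EJA E) : Set E := {z : E | ∃ y : E, z = J.jmul y y}

/-- `y` has rank `k`: some spectral decomposition of `y` has exactly `k`
nonzero eigenvalues.  (By uniqueness of eigenvalues this is well-defined.) -/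
def HasRank (J : EJA E) (y : E) (k : ℕ) : Prop :=
  ∃ (c : Fin J.rank → E) (σ : Fin J.rank → ℝ),
    J.IsJordanFrame c ∧ y = ∑ i, σ i • c i ∧
      (Finset.univ.filter (fun i => σ i ≠ 0)).card = k

/-- `t` is an eigenvalue of `y`. -/
def IsEigenvalue (J : EJA E) (y : E) (t : ℝ) : Prop :=
  ∃ (c : Fin J.rank → E) (σ : Fin J.rank → ℝ) (i : Fin J.rank),
    J.IsJordanFrame c ∧ y = ∑ j, σ j • c j ∧ σ i = t

/-- `p` is a nearest point of the symmetric cone `K` to `v`. -/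
def IsProj (J : EJA E) (v p : E) : Prop :=
  p ∈ J.K ∧ ∀ z ∈ J.K, ‖v - p‖ ≤ ‖v - z‖

/-- A (linear subspace that is a) subalgebra. -/
def IsSubalgebra (J : EJA E) (V : Submodule ℝ E) : Prop :=
  ∀ a ∈ V, ∀ b ∈ V, J.jmul a b ∈ V

/-- The algebra is simple: it is not the direct sum of two nonzero
subalgebras. -/
def IsSimple (J : EJA E) : Prop :=
  ¬ ∃ V W : Submodule ℝ E, J.IsSubalgebra V ∧ J.IsSubalgebra W ∧
      V ≠ ⊥ ∧ W ≠ ⊥ ∧ V ⊓ W = ⊥ ∧ V ⊔ W = ⊤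

/-- The tangent cone of the convex set `K` at `z`:
the closure of `⋃_{t>0} t (K - z)`. -/
def tangentCone (J : EJA E) (z : E) : Set E :=
  closure {d : E | ∃ t : ℝ, 0 < t ∧ ∃ k ∈ J.K, d = t • (k - z)}

/-- The lineality space `T_K(z) ∩ (-T_K(z))` of the tangent cone. -/
def linTangent (J : EJA E) (z : E) : Set E :=
  {d : E | d ∈ J.tangentCone z ∧ -d ∈ J.tangentCone z}

/-- The Lagrangian of problem (P1):
`L(x, μ, λ) = f(x) - ⟪h(x), μ⟫ - ⟪g(x), λ⟫`. -/
def lagr {n m : ℕ} (f : EuclideanSpace ℝ (Fin n) → ℝ)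
    (h : EuclideanSpace ℝ (Fin n) → EuclideanSpace ℝ (Fin m))
    (g : EuclideanSpace ℝ (Fin n) → E) (μ : EuclideanSpace ℝ (Fin m)) (lam : E)
    (x : EuclideanSpace ℝ (Fin n)) : ℝ :=
  f x - ⟪h x, μ⟫ - ⟪g x, lam⟫

/-- The Lagrangian of the slack-variable problem (P2), as a function of the
pair `(x, y)`. -/
def lagrSlack (J : EJA E) {n m : ℕ} (f : EuclideanSpace ℝ (Fin n) → ℝ)
    (h : EuclideanSpace ℝ (Fin n) → EuclideanSpace ℝ (Fin m))
    (g : EuclideanSpace ℝ (Fin n) → E) (μ : EuclideanSpace ℝ (Fin m)) (lam : E)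
    (p : EuclideanSpace ℝ (Fin n) × E) : ℝ :=
  f p.1 - ⟪h p.1, μ⟫ - ⟪g p.1 - J.jmul p.2 p.2, lam⟫

/-- `(x, μ, lam)` is a KKT triple of problem (P1). -/
def KKTP1 (J : EJA E) {n m : ℕ} (f : EuclideanSpace ℝ (Fin n) → ℝ)
    (h : EuclideanSpace ℝ (Fin n) → EuclideanSpace ℝ (Fin m))
    (g : EuclideanSpace ℝ (Fin n) → E)
    (x : EuclideanSpace ℝ (Fin n)) (μ : EuclideanSpace ℝ (Fin m)) (lam : E) : Prop :=
  gradient f x - (fderiv ℝ h x).adjoint μ - (fderiv ℝ g x).adjoint lam = 0 ∧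
    lam ∈ J.K ∧ g x ∈ J.K ∧ J.jmul lam (g x) = 0 ∧ h x = 0

/-- `(x, y, μ, lam)` is a KKT quadruple of the slack-variable problem (P2). -/
def KKTP2 (J : EJA E) {n m : ℕ} (f : EuclideanSpace ℝ (Fin n) → ℝ)
    (h : EuclideanSpace ℝ (Fin n) → EuclideanSpace ℝ (Fin m))
    (g : EuclideanSpace ℝ (Fin n) → E)
    (x : EuclideanSpace ℝ (Fin n)) (y : E) (μ : EuclideanSpace ℝ (Fin m))
    (lam : E) : Prop :=
  gradient f x - (fderiv ℝ h x).adjoint μ - (fderiv ℝ g x).adjoint lam = 0 ∧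
    J.jmul lam y = 0 ∧ g x = J.jmul y y ∧ h x = 0

/-- The augmented Lagrangian of the slack-variable problem (P2). -/
def augSlack (J : EJA E) {n m : ℕ} (f : EuclideanSpace ℝ (Fin n) → ℝ)
    (h : EuclideanSpace ℝ (Fin n) → EuclideanSpace ℝ (Fin m))
    (g : EuclideanSpace ℝ (Fin n) → E) (ρ : ℝ) (μ : EuclideanSpace ℝ (Fin m))
    (lam : E) (x : EuclideanSpace ℝ (Fin n)) (y : E) : ℝ :=
  f x - ⟪h x, μ⟫ + ρ / 2 * ‖h x‖ ^ 2 - ⟪g x - J.jmul y y, lam⟫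
    + ρ / 2 * ‖g x - J.jmul y y‖ ^ 2

/-- The augmented Lagrangian of problem (P1), where `P` is the metric
projection onto the symmetric cone `K`. -/
def augSym (J : EJA E) {n m : ℕ} (f : EuclideanSpace ℝ (Fin n) → ℝ)
    (h : EuclideanSpace ℝ (Fin n) → EuclideanSpace ℝ (Fin m))
    (g : EuclideanSpace ℝ (Fin n) → E) (P : E → E) (ρ : ℝ)
    (μ : EuclideanSpace ℝ (Fin m)) (lam : E)
    (x : EuclideanSpace ℝ (Fin n)) : ℝ :=
  f x - ⟪h x, μ⟫ + ρ / 2 * ‖h x‖ ^ 2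
    + 1 / (2 * ρ) * (-‖lam‖ ^ 2 + ‖P (lam - ρ • g x)‖ ^ 2)

end EJA

namespace EJA

variable {E : Type*} [NormedAddCommGroup E] [InnerProductSpace ℝ E]
  [FiniteDimensional ℝ E]

/-- The Peirce relation `2 L³ - 3 L² + L = 0` for multiplication `L` by an idempotent. -/
theorem IsIdempotent.peirce {J : EJA E} {c : E} (hc : J.IsIdempotent c) (w : E) :
    (2 : ℝ) • J.jmul c (J.jmul c (J.jmul c w)) - (3 : ℝ) • J.jmul c (J.jmul c w)
      + J.jmul c w = 0 := by
  have hc' : J.jmul c c = c := hc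
  have h₁ := J.jordan (c + w) c
  have h₂ := J.jordan (c - w) c
  have h₃ := J.jordan w c
  simp only [map_add, map_sub, LinearMap.add_apply, LinearMap.sub_apply, hc', J.comm w c,
    J.comm (J.jmul c w) c, J.comm (J.jmul w w) c] at h₁ h₂ h₃
  linear_combination (norm := module) (1 / 2 : ℝ) • (h₁ - h₂) - h₃

/-- The inner product of an idempotent with a square is nonnegative. -/
theorem IsIdempotent.inner_square_nonneg {J : EJA E} {c : E} (hc : J.IsIdempotent c) (x : E) :
    0 ≤ ⟪c, J.jmul x x⟫ := by
  have hself : ∀ u v : E, ⟪J.jmul c u, v⟫ = ⟪u, J.jmul c v⟫ := fun u v => by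
    rw [J.comm c u, J.assoc_inner]
  rw [← J.assoc_inner]
  have hpeirce := hc.peirce x
  set a := J.jmul c x with ha
  set b := J.jmul c a with hb
  have hbx : ⟪b, x⟫ = ⟪a, a⟫ := by rw [hb, hself]
  have hdx : ⟪J.jmul c b, x⟫ = ⟪b, a⟫ := by rw [hself]
  have hda : ⟪J.jmul c b, a⟫ = ⟪b, b⟫ := by rw [hself]
  have hx := congrArg (fun u => ⟪u, x⟫) hpeirce
  have ha := congrArg (fun u => ⟪u, a⟫) hpeirce
  simp only [inner_add_left, inner_sub_left, real_inner_smul_left, inner_zero_left, hbx, hdx,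
    hda] at hx ha
  have hP := real_inner_self_nonneg (x := (2 : ℝ) • b - a)
  have hQ := real_inner_self_nonneg (x := a - b)
  simp only [inner_sub_left, inner_sub_right, real_inner_smul_left, real_inner_smul_right,
    real_inner_comm b a] at hP hQ
  linarith [real_inner_comm a b]

/-- Jordan-orthogonal idempotents are orthogonal for the inner product. -/
theorem IsIdempotent.inner_eq_zero {J : EJA E} {c d : E} (hc : J.IsIdempotent c)
    (hcd : J.jmul c d = 0) : ⟪c, d⟫ = 0 := by
  have h := J.assoc_inner c c d
  rwa [hcd, inner_zero_right, show J.jmul c c = c from hc] at h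

/-- Linear combinations of a Jordan frame multiply coordinatewise. -/
theorem IsJordanFrame.jmul_sum {J : EJA E} {c : Fin J.rank → E} (hc : J.IsJordanFrame c)
    (s t : Fin J.rank → ℝ) :
    J.jmul (∑ i, s i • c i) (∑ i, t i • c i) = ∑ i, (s i * t i) • c i := by
  simp only [map_sum, map_smul, LinearMap.sum_apply, LinearMap.smul_apply]
  refine Finset.sum_congr rfl fun i _ => ?_
  rw [Finset.sum_eq_single i]
  · rw [show J.jmul (c i) (c i) = c i from (hc.1 i).1, smul_smul, mul_comm]
  · intro j _ hj
    rw [hc.2.1 j i hj, smul_zero]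
  · simp

/-- Coordinatewise nonnegative combinations of a Jordan frame lie in the symmetric cone. -/
theorem IsJordanFrame.sum_mem_K {J : EJA E} {c : Fin J.rank → E} (hc : J.IsJordanFrame c)
    {s : Fin J.rank → ℝ} (hs : ∀ i, 0 ≤ s i) : ∑ i, s i • c i ∈ J.K := by
  refine ⟨∑ i, √(s i) • c i, ?_⟩
  rw [hc.jmul_sum]
  exact Finset.sum_congr rfl fun i _ => by rw [Real.mul_self_sqrt (hs i)]

end EJA

/-- the projection of `y` onto the symmetric cone `K` is obtained
by zeroing the negative eigenvalues of `y`, and it is the unique minimizer of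
`‖y - z‖` over `z ∈ K`. -/
theorem stmt0 {E : Type*} [NormedAddCommGroup E] [InnerProductSpace ℝ E]
    [FiniteDimensional ℝ E] (J : EJA E) (y : E)
    (c : Fin J.rank → E) (σ : Fin J.rank → ℝ)
    (hc : J.IsJordanFrame c) (hy : y = ∑ i, σ i • c i)
    (p : E) (hp : p = ∑ i, max (σ i) 0 • c i) :
    J.IsProj y p ∧ ∀ z ∈ J.K, z ≠ p → ‖y - p‖ < ‖y - z‖ := by
  have hsub : y - p = ∑ i, min (σ i) 0 • c i := by
    rw [hy, hp, ← Finset.sum_sub_distrib]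
    refine Finset.sum_congr rfl fun i _ => ?_
    rw [← sub_smul]
    congr 1
    linarith [min_add_max (σ i) 0]
  have hmem : p ∈ J.K := hp ▸ hc.sum_mem_K fun i => le_max_right _ _
  have horth : ⟪y - p, p⟫ = 0 := by
    rw [hsub, hp]
    simp only [sum_inner, inner_sum, real_inner_smul_left, real_inner_smul_right]
    refine Finset.sum_eq_zero fun i _ => Finset.sum_eq_zero fun j _ => ?_
    rcases eq_or_ne i j with rfl | hij
    · rcases le_total (σ i) 0 with h | h <;> simp [h]
    · simp [(hc.1 j).1.inner_eq_zero (hc.2.1 j i hij.symm)]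
  have hpolar : ∀ z ∈ J.K, ⟪y - p, z⟫ ≤ 0 := by
    rintro _ ⟨x, rfl⟩
    rw [hsub, sum_inner]
    refine Finset.sum_nonpos fun i _ => ?_
    rw [real_inner_smul_left]
    exact mul_nonpos_of_nonpos_of_nonneg (min_le_right _ _) ((hc.1 i).1.inner_square_nonneg x)
  have hpyth : ∀ z ∈ J.K, ‖y - p‖ ^ 2 + ‖p - z‖ ^ 2 ≤ ‖y - z‖ ^ 2 := by
    intro z hz
    have h := norm_add_sq_real (y - p) (p - z)
    rw [sub_add_sub_cancel, inner_sub_right, horth] at h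
    linarith [hpolar z hz]
  refine ⟨⟨hmem, fun z hz => ?_⟩, fun z hz hne => ?_⟩
  · exact (sq_le_sq₀ (norm_nonneg _) (norm_nonneg _)).mp
      (by linarith [hpyth z hz, sq_nonneg ‖p - z‖])
  · have hpos : 0 < ‖p - z‖ := norm_pos_iff.mpr (sub_ne_zero.mpr hne.symm)
    exact lt_of_pow_lt_pow_left₀ 2 (norm_nonneg _) (by linarith [hpyth z hz, pow_pos hpos 2])
end
end

section
/- Let (x, y) be a local minimum of problem (P2) and let (x, y, μ, λ) be a KKT quadruple of (P2) at which LICQ holds, i.e., for all v ∈ ℝᵐ and w ∈ E, if y∘w = 0 and Dg(x)*w + Dh(x)*v = 0 then v = 0 and w = 0. Then ⟨∇²_x L(x,μ,λ)v, v⟩ + 2⟨w∘w, λ⟩ ≥ 0 for every (v, w) ∈ ℝⁿ × E satisfying Dg(x)v − 2 y∘w = 0 and Dh(x)v = 0. -/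
open scoped RealInnerProductSpace

noncomputable section

open Filter Topology Asymptotics

/-- Second-order Taylor expansion of a `C²` function at a critical point. -/
theorem ContDiff.isLittleO_sub_half_fderiv_fderiv {V : Type*} [NormedAddCommGroup V]
    [NormedSpace ℝ V] {F : V → ℝ} (hF : ContDiff ℝ 2 F) {x : V} (hx : fderiv ℝ F x = 0) :
    (fun z => F z - F x - 1 / 2 * fderiv ℝ (fderiv ℝ F) x (z - x) (z - x))
      =o[𝓝 x] fun z => ‖z - x‖ ^ 2 := by
  set B := fderiv ℝ (fderiv ℝ F) x
  have hsymm : ∀ v w, B v w = B w v :=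
    (hF.contDiffAt (x := x)).isSymmSndFDerivAt (by simp)
  have hderiv : ∀ z, HasFDerivAt
      (fun z => F z - 1 / 2 * B (z - x) (z - x)) (fderiv ℝ F z - B (z - x)) z := by
    intro z
    have hs : HasFDerivAt (fun z => z - x) (ContinuousLinearMap.id ℝ V) z :=
      (hasFDerivAt_id z).sub_const x
    have hq := (B.hasFDerivAt_of_bilinear hs hs).const_mul (1 / 2 : ℝ)
    convert! ((hF.differentiable two_ne_zero) z).hasFDerivAt.sub hq using 1
    ext w
    simp [hsymm w]
    ring
  have hsmall : (fun z => fderiv ℝ F z - B (z - x)) =o[𝓝 x] fun z => ‖z - x‖ ^ 1 := by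
    have hd : HasFDerivAt (fderiv ℝ F) B x :=
      ((hF.fderiv_right (m := 1) (by norm_num)).differentiable one_ne_zero x).hasFDerivAt
    simpa [hx] using hd.isLittleO.norm_right
  have := convex_univ.isLittleO_pow_succ (Set.mem_univ x)
    (fun z _ => (hderiv z).hasFDerivWithinAt) (by simpa only [nhdsWithin_univ] using hsmall)
  simpa [sub_right_comm] using this

/-- Second-order behaviour of a `C²` function at a critical point along a curve that is merely
differentiable at the base point. -/
theorem ContDiff.tendsto_second_order_quotient {V : Type*} [NormedAddCommGroup V]
    [NormedSpace ℝ V] {F : V → ℝ} (hF : ContDiff ℝ 2 F) {γ : ℝ → V} {v : V}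
    (hγ : HasDerivAt γ v 0) (hx : fderiv ℝ F (γ 0) = 0) :
    Tendsto (fun t : ℝ => (F (γ t) - F (γ 0)) / t ^ 2) (𝓝[≠] 0)
      (𝓝 (1 / 2 * fderiv ℝ (fderiv ℝ F) (γ 0) v v)) := by
  set B := fderiv ℝ (fderiv ℝ F) (γ 0)
  have hslope : Tendsto (fun t : ℝ => t⁻¹ • (γ t - γ 0)) (𝓝[≠] 0) (𝓝 v) := by
    simpa using hasDerivAt_iff_tendsto_slope_zero.1 hγ
  have hB : Tendsto (fun t : ℝ => 1 / 2 * B (t⁻¹ • (γ t - γ 0)) (t⁻¹ • (γ t - γ 0)))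
      (𝓝[≠] 0) (𝓝 (1 / 2 * B v v)) :=
    ((B.isBoundedBilinearMap.continuous.tendsto (v, v)).comp
      (hslope.prodMk_nhds hslope)).const_mul _
  have hrem : Tendsto (fun t : ℝ =>
      (F (γ t) - F (γ 0) - 1 / 2 * B (γ t - γ 0) (γ t - γ 0)) / t ^ 2) (𝓝[≠] 0) (𝓝 0) := by
    have hO : (fun t : ℝ => ‖γ t - γ 0‖ ^ 2) =O[𝓝 0] fun t : ℝ => t ^ 2 := by
      simpa using hγ.isBigO_sub.norm_left.pow 2
    have ho := (hF.isLittleO_sub_half_fderiv_fderiv hx).comp_tendsto hγ.continuousAt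
    exact ((ho.trans_isBigO hO).mono nhdsWithin_le_nhds).tendsto_div_nhds_zero
  have hsum := hrem.add hB
  rw [zero_add] at hsum
  refine hsum.congr' ?_
  filter_upwards [self_mem_nhdsWithin] with t ht
  have ht : t ≠ 0 := ht
  simp only [map_smul, smul_apply, smul_eq_mul]
  field_simp
  ring

/-- Every vector in the kernel of a surjective strict derivative is the velocity of a curve in the
level set. -/
theorem HasStrictFDerivAt.exists_curve_of_mem_ker {V W : Type*} [NormedAddCommGroup V]
    [NormedSpace ℝ V] [CompleteSpace V] [NormedAddCommGroup W] [NormedSpace ℝ W]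
    [FiniteDimensional ℝ W] {G : V → W} {G' : V →L[ℝ] W} {a : V}
    (hG : HasStrictFDerivAt G G' a) (hsurj : G'.range = ⊤) {u : V} (hu : G' u = 0) :
    ∃ γ : ℝ → V, γ 0 = a ∧ HasDerivAt γ u 0 ∧ ∀ᶠ t in 𝓝 0, G (γ t) = G a := by
  let k : G'.ker := ⟨u, hu⟩
  have hline : HasDerivAt (fun t : ℝ => t • k) k 0 := by
    simpa using (hasDerivAt_id (0 : ℝ)).smul_const k
  have hcont : Tendsto (fun t : ℝ => t • k) (𝓝 0) (𝓝 0) := by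
    simpa using hline.continuousAt.tendsto
  refine ⟨fun t => hG.implicitFunction G G' hsurj (G a) (t • k), by simp, ?_, ?_⟩
  · have hφ := (hG.to_implicitFunction hsurj).hasFDerivAt
    rw [← zero_smul ℝ k] at hφ
    exact hφ.comp_hasDerivAt (0 : ℝ) hline
  · exact (tendsto_const_nhds.prodMk_nhds hcont).eventually (hG.map_implicitFunction_eq hsurj)

/-- A continuous linear map into a product of Euclidean spaces is surjective if its adjoint,
written componentwise, is injective. -/
theorem ContinuousLinearMap.range_prod_eq_top_of_inner {V F₁ F₂ : Type*}
    [NormedAddCommGroup V] [NormedSpace ℝ V]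
    [NormedAddCommGroup F₁] [InnerProductSpace ℝ F₁] [FiniteDimensional ℝ F₁]
    [NormedAddCommGroup F₂] [InnerProductSpace ℝ F₂] [FiniteDimensional ℝ F₂]
    (A : V →L[ℝ] F₁) (B : V →L[ℝ] F₂)
    (hinj : ∀ a b, (∀ u, ⟪a, A u⟫ + ⟪b, B u⟫ = 0) → a = 0 ∧ b = 0) :
    (A.prod B).range = ⊤ := by
  have := FiniteDimensional.complete ℝ F₁
  have := FiniteDimensional.complete ℝ F₂
  by_contra hne
  obtain ⟨φ, hφ, hle⟩ := Submodule.exists_le_ker_of_lt_top _ (lt_top_iff_ne_top.2 hne)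
  let a : F₁ := (InnerProductSpace.toDual ℝ F₁).symm
    (LinearMap.toContinuousLinearMap (φ ∘ₗ LinearMap.inl ℝ F₁ F₂))
  let b : F₂ := (InnerProductSpace.toDual ℝ F₂).symm
    (LinearMap.toContinuousLinearMap (φ ∘ₗ LinearMap.inr ℝ F₁ F₂))
  have hab : ∀ p q, φ (p, q) = ⟪a, p⟫ + ⟪b, q⟫ := by
    intro p q
    simp [a, b, ← map_add]
  obtain ⟨ha, hb⟩ := hinj a b fun u => by
    rw [← hab]
    exact hle ⟨u, rfl⟩
  apply hφ
  ext p <;> simp [hab, ha, hb]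

/-- second order necessary condition for (P2) under LICQ at a
local minimum. -/
theorem stmt3 {E : Type*} [NormedAddCommGroup E] [InnerProductSpace ℝ E]
    [FiniteDimensional ℝ E] (J : EJA E) {n m : ℕ}
    (f : EuclideanSpace ℝ (Fin n) → ℝ)
    (h : EuclideanSpace ℝ (Fin n) → EuclideanSpace ℝ (Fin m))
    (g : EuclideanSpace ℝ (Fin n) → E)
    (hf : ContDiff ℝ 2 f) (hh : ContDiff ℝ 2 h) (hg : ContDiff ℝ 2 g)
    (x : EuclideanSpace ℝ (Fin n)) (y : E)
    (μ : EuclideanSpace ℝ (Fin m)) (lam : E)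
    (hmin : IsLocalMinOn (fun p : EuclideanSpace ℝ (Fin n) × E => f p.1)
      {p : EuclideanSpace ℝ (Fin n) × E | h p.1 = 0 ∧ g p.1 = J.jmul p.2 p.2}
      (x, y))
    (hKKT : J.KKTP2 f h g x y μ lam)
    (hLICQ : ∀ (v : EuclideanSpace ℝ (Fin m)) (w : E), J.jmul y w = 0 →
      (fderiv ℝ g x).adjoint w + (fderiv ℝ h x).adjoint v = 0 →
      v = 0 ∧ w = 0) :
    ∀ (v : EuclideanSpace ℝ (Fin n)) (w : E),
      fderiv ℝ g x v - (2 : ℝ) • J.jmul y w = 0 → fderiv ℝ h x v = 0 →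
      0 ≤ iteratedFDeriv ℝ 2 (EJA.lagr f h g μ lam) x ![v, v]
          + 2 * ⟪J.jmul w w, lam⟫ := by
  intro v w hvw hv
  obtain ⟨hgrad, hlamy, hgx, hhx⟩ := hKKT
  let M : E →L[ℝ] E →L[ℝ] E := J.jmul.toContinuousBilinearMap
  have hM : ∀ a b, M a b = J.jmul a b := fun _ _ => rfl
  let A := (fderiv ℝ h x).comp (ContinuousLinearMap.fst ℝ (EuclideanSpace ℝ (Fin n)) E)
  let B := (fderiv ℝ g x).comp (ContinuousLinearMap.fst ℝ (EuclideanSpace ℝ (Fin n)) E)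
    - (2 : ℝ) • (M y).comp (ContinuousLinearMap.snd ℝ (EuclideanSpace ℝ (Fin n)) E)
  let G : EuclideanSpace ℝ (Fin n) × E → EuclideanSpace ℝ (Fin m) × E :=
    fun p => (h p.1, g p.1 - J.jmul p.2 p.2)
  have hG : HasStrictFDerivAt G (A.prod B) (x, y) := by
    have h₁ : HasStrictFDerivAt (fun p : EuclideanSpace ℝ (Fin n) × E => h p.1) A (x, y) :=
      (hh.contDiffAt.hasStrictFDerivAt two_ne_zero).comp (x, y) hasStrictFDerivAt_fst
    have h₂ : HasStrictFDerivAt (fun p : EuclideanSpace ℝ (Fin n) × E => g p.1)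
        ((fderiv ℝ g x).comp (ContinuousLinearMap.fst ℝ (EuclideanSpace ℝ (Fin n)) E)) (x, y) :=
      (hg.contDiffAt.hasStrictFDerivAt two_ne_zero).comp (x, y) hasStrictFDerivAt_fst
    have h₃ : HasStrictFDerivAt (fun p : EuclideanSpace ℝ (Fin n) × E => M p.2 p.2)
        ((2 : ℝ) • (M y).comp (ContinuousLinearMap.snd ℝ (EuclideanSpace ℝ (Fin n)) E))
        (x, y) := by
      have hb := (M.isBoundedBilinearMap.hasStrictFDerivAt (y, y)).comp (x, y)
        ((hasStrictFDerivAt_snd (𝕜 := ℝ) (p := (x, y))).prodMk hasStrictFDerivAt_snd)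
      refine hb.congr_fderiv ?_
      ext p
      · simp
      · simp [hM, J.comm p y, two_smul]
    exact h₁.prodMk (h₂.sub h₃)
  have hsurj : (A.prod B).range = ⊤ := by
    refine A.range_prod_eq_top_of_inner B fun a b hab => hLICQ a b ?_ ?_
    · refine ext_inner_right ℝ fun q => ?_
      have hq := hab (0, q)
      simp only [A, B, ContinuousLinearMap.comp_apply, sub_apply,
        smul_apply, ContinuousLinearMap.coe_fst',
        ContinuousLinearMap.coe_snd', map_zero, inner_zero_right, zero_add, zero_sub,
        inner_neg_right, inner_smul_right, hM] at hq
      rw [inner_zero_left, J.comm, J.assoc_inner]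
      linarith
    · refine ext_inner_right ℝ fun q => ?_
      have hq := hab (q, 0)
      simp only [A, B, ContinuousLinearMap.comp_apply, sub_apply,
        smul_apply, ContinuousLinearMap.coe_fst',
        ContinuousLinearMap.coe_snd', map_zero, smul_zero, sub_zero] at hq
      rw [inner_zero_left, inner_add_left, ContinuousLinearMap.adjoint_inner_left,
        ContinuousLinearMap.adjoint_inner_left]
      linarith
  obtain ⟨γ, hγ0, hγ, hfeas⟩ := hG.exists_curve_of_mem_ker hsurj (u := (v, w)) (by
    simpa [A, B, hM, hv] using hvw)
  have hγ₁ : HasDerivAt (fun t => (γ t).1) v 0 :=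
    (hasFDerivAt_fst (𝕜 := ℝ) (p := γ 0)).comp_hasDerivAt 0 hγ
  have hγ₂ : HasDerivAt (fun t => (γ t).2) w 0 :=
    (hasFDerivAt_snd (𝕜 := ℝ) (p := γ 0)).comp_hasDerivAt 0 hγ
  have hL : ContDiff ℝ 2 (EJA.lagr f h g μ lam) :=
    (hf.sub (hh.inner ℝ contDiff_const)).sub (hg.inner ℝ contDiff_const)
  have hcrit : fderiv ℝ (EJA.lagr f h g μ lam) x = 0 := by
    have hfd := (hf.differentiable two_ne_zero x).hasFDerivAt
    have hhd := ((hh.differentiable two_ne_zero x).hasFDerivAt).inner ℝ (hasFDerivAt_const μ x)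
    have hgd := ((hg.differentiable two_ne_zero x).hasFDerivAt).inner ℝ (hasFDerivAt_const lam x)
    refine ((hfd.sub hhd).sub hgd).fderiv.trans ?_
    ext q
    have hq := congrArg (fun z => ⟪z, q⟫) hgrad
    simp only [inner_sub_left, ContinuousLinearMap.adjoint_inner_left, inner_zero_left,
      gradient, InnerProductSpace.toDual_symm_apply] at hq
    simp [real_inner_comm μ, real_inner_comm lam] at hq ⊢
    linarith
  have hlim₁ := hL.tendsto_second_order_quotient hγ₁ (by simpa [hγ0] using hcrit)
  have hlim₂ : Tendsto (fun t : ℝ =>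
      ⟪M (t⁻¹ • ((γ t).2 - y)) (t⁻¹ • ((γ t).2 - y)), lam⟫) (𝓝[≠] 0) (𝓝 ⟪M w w, lam⟫) := by
    have hs : Tendsto (fun t : ℝ => t⁻¹ • ((γ t).2 - y)) (𝓝[≠] 0) (𝓝 w) := by
      simpa [hγ0] using hasDerivAt_iff_tendsto_slope_zero.1 hγ₂
    exact ((M.isBoundedBilinearMap.continuous.tendsto (w, w)).comp
      (hs.prodMk_nhds hs)).inner tendsto_const_nhds
  have hlamy' : J.jmul y lam = 0 := by rw [J.comm, hlamy]
  have hsq : ∀ z, ⟪J.jmul z z, lam⟫ = ⟪J.jmul (z - y) (z - y), lam⟫ := by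
    intro z
    simp only [map_sub, LinearMap.sub_apply, inner_sub_left]
    have h₁ : ⟪J.jmul z y, lam⟫ = 0 := by rw [J.assoc_inner, hlamy', inner_zero_right]
    have h₂ : ⟪J.jmul y y, lam⟫ = 0 := by rw [J.assoc_inner, hlamy', inner_zero_right]
    rw [J.comm y z, h₁, h₂]
    ring
  have hG0 : G (x, y) = 0 := by simp [G, hhx, hgx]
  have hfeas' : ∀ᶠ t in 𝓝 0, h (γ t).1 = 0 ∧ g (γ t).1 = J.jmul (γ t).2 (γ t).2 := by
    filter_upwards [hfeas] with t ht
    rw [hG0] at ht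
    exact ⟨congrArg Prod.fst ht, sub_eq_zero.1 (congrArg Prod.snd ht)⟩
  have hmono : ∀ᶠ t in 𝓝 0, f x ≤ f (γ t).1 := by
    have hc : Tendsto γ (𝓝 0) (𝓝 (x, y)) := hγ0 ▸ hγ.continuousAt.tendsto
    exact (tendsto_nhdsWithin_iff.2 ⟨hc, hfeas'⟩).eventually hmin
  have hnonneg := ge_of_tendsto (hlim₁.add hlim₂) (b := 0) (by
    filter_upwards [self_mem_nhdsWithin, nhdsWithin_le_nhds hfeas',
      nhdsWithin_le_nhds hmono] with t ht hft hmt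
    have ht : t ≠ 0 := ht
    have hval : EJA.lagr f h g μ lam (γ t).1 - EJA.lagr f h g μ lam x
        + ⟪J.jmul ((γ t).2 - y) ((γ t).2 - y), lam⟫ = f (γ t).1 - f x := by
      simp only [EJA.lagr, hft.1, hft.2, hhx, hgx, inner_zero_left]
      rw [hsq (γ t).2, hsq y, sub_self, map_zero, inner_zero_left]
      ring
    have hquot : (EJA.lagr f h g μ lam (γ t).1 - EJA.lagr f h g μ lam (γ 0).1) / t ^ 2
        + ⟪M (t⁻¹ • ((γ t).2 - y)) (t⁻¹ • ((γ t).2 - y)), lam⟫ = (f (γ t).1 - f x) / t ^ 2 := by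
      rw [← hval, hγ0]
      simp only [map_smul, smul_apply, inner_smul_left, hM]
      simp
      field_simp
    rw [hquot]
    exact div_nonneg (sub_nonneg.2 hmt) (sq_nonneg t))
  rw [iteratedFDeriv_two_apply]
  simp only [hγ0, hM] at hnonneg
  simp only [Matrix.cons_val_zero, Matrix.cons_val_one]
  linarith
end
end

section
/- Let (x, y, μ, λ) ∈ ℝⁿ × E × ℝᵐ × E be a KKT quadruple of problem (P2), where E has rank r, and suppose that ⟨w∘w, λ⟩ > 0 for every nonzero w ∈ E with y∘w = 0. Then (x, μ, λ) is a KKT triple of problem (P1) satisfying strict complementarity, i.e., rank g(x) + rank λ = r. -/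
open scoped RealInnerProductSpace

noncomputable section

namespace EJA

variable {E : Type*} [NormedAddCommGroup E] [InnerProductSpace ℝ E]
  [FiniteDimensional ℝ E]

/-- The Jordan identity, linearized once. -/
theorem jordan_linearized (J : EJA E) (y a z : E) :
    J.jmul a (J.jmul (J.jmul y y) z) + (2 : ℝ) • J.jmul y (J.jmul (J.jmul y a) z) =
      J.jmul (J.jmul y y) (J.jmul a z) + (2 : ℝ) • J.jmul (J.jmul y a) (J.jmul y z) := by
  have h₁ := J.jordan (y + a) z
  have h₂ := J.jordan (y - a) z
  have h₃ := J.jordan a z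
  simp only [map_add, map_sub, LinearMap.add_apply, LinearMap.sub_apply, J.comm a y] at h₁ h₂
  linear_combination (norm := module) (1 / 2 : ℝ) • h₁ - (1 / 2 : ℝ) • h₂ - h₃

/-- The fully linearized Jordan identity. -/
theorem jordan_polarized (J : EJA E) (a b c z : E) :
    J.jmul a (J.jmul (J.jmul b c) z) + J.jmul b (J.jmul (J.jmul a c) z) +
        J.jmul c (J.jmul (J.jmul a b) z) =
      J.jmul (J.jmul b c) (J.jmul a z) + J.jmul (J.jmul a c) (J.jmul b z) +
        J.jmul (J.jmul a b) (J.jmul c z) := by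
  have h₁ := J.jordan_linearized (b + c) a z
  have h₂ := J.jordan_linearized b a z
  have h₃ := J.jordan_linearized c a z
  simp only [map_add, LinearMap.add_apply, J.comm c b, J.comm b a, J.comm c a] at h₁ h₂ h₃
  linear_combination (norm := module) (1 / 2 : ℝ) • h₁ - (1 / 2 : ℝ) • h₂ - (1 / 2 : ℝ) • h₃

theorem inner_jmul_left (J : EJA E) (a u v : E) : ⟪J.jmul a u, v⟫ = ⟪u, J.jmul a v⟫ := by
  rw [J.comm a u, J.assoc_inner]

theorem jmul_unit (J : EJA E) (y : E) : J.jmul y J.unit = y := by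
  rw [J.comm, J.unit_jmul]

/-- Multiplication by `y` commutes with multiplication by `u ∘ v` when `u` and `v` annihilate
`y`. -/
theorem jmul_jmul_comm_of_jmul_eq_zero (J : EJA E) {y u v : E} (hu : J.jmul y u = 0)
    (hv : J.jmul y v = 0) (z : E) :
    J.jmul y (J.jmul (J.jmul u v) z) = J.jmul (J.jmul u v) (J.jmul y z) := by
  simpa [hu, hv] using J.jordan_polarized y u v z

/-- Multiplication by `y ∘ y` commutes with multiplication by any element annihilating `y`. -/
theorem jmul_sq_comm_of_jmul_eq_zero (J : EJA E) {y a : E} (ha : J.jmul y a = 0) (z : E) :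
    J.jmul a (J.jmul (J.jmul y y) z) = J.jmul (J.jmul y y) (J.jmul a z) := by
  simpa [ha] using J.jordan_linearized y a z

namespace IsIdempotent

variable {J : EJA E} {c : E}

/-- The Peirce polynomial identity `2L³ - 3L² + L = 0`, where `L` is multiplication by `c`. -/
theorem peirce_s9 (hc : J.IsIdempotent c) (z : E) :
    (2 : ℝ) • J.jmul c (J.jmul c (J.jmul c z)) =
      (3 : ℝ) • J.jmul c (J.jmul c z) - J.jmul c z := by
  have hc' : J.jmul c c = c := hc
  have h := J.jordan_linearized c z c
  rw [hc', hc', J.comm (J.jmul c z) c, J.comm z c] at h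
  linear_combination (norm := module) h

/-- Multiplication by an idempotent is positive semidefinite, as an explicit sum of squares. -/
theorem inner_jmul_self_eq (hc : J.IsIdempotent c) (w : E) :
    ⟪c, J.jmul w w⟫ =
      ‖J.jmul c w‖ ^ 2 + 4 * ‖J.jmul c w - J.jmul c (J.jmul c w)‖ ^ 2 := by
  have h₁ := congrArg (fun u => ⟪w, u⟫) (hc.peirce_s9 w)
  have h₂ := congrArg (fun u => ⟪w, u⟫) (hc.peirce_s9 (J.jmul c w))
  simp only [inner_smul_right, inner_sub_right] at h₁ h₂
  rw [← J.assoc_inner, ← real_inner_self_eq_norm_sq, ← real_inner_self_eq_norm_sq]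
  simp only [inner_sub_left, inner_sub_right, J.inner_jmul_left]
  linarith

theorem inner_jmul_self_nonneg (hc : J.IsIdempotent c) (w : E) : 0 ≤ ⟪c, J.jmul w w⟫ := by
  rw [hc.inner_jmul_self_eq]
  positivity

theorem jmul_eq_zero_of_inner_jmul_self (hc : J.IsIdempotent c) {w : E}
    (hw : ⟪c, J.jmul w w⟫ = 0) : J.jmul c w = 0 := by
  rw [hc.inner_jmul_self_eq] at hw
  have : ‖J.jmul c w‖ ^ 2 = 0 := by
    nlinarith [sq_nonneg ‖J.jmul c w‖, sq_nonneg ‖J.jmul c w - J.jmul c (J.jmul c w)‖]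
  simpa using this

theorem jmul_comm_of_jmul_eq_zero (hc : J.IsIdempotent c) {a : E} (ha : J.jmul c a = 0) (z : E) :
    J.jmul a (J.jmul c z) = J.jmul c (J.jmul a z) := by
  have hc' : J.jmul c c = c := hc
  simpa only [hc'] using J.jmul_sq_comm_of_jmul_eq_zero ha z

theorem unit_sub (hc : J.IsIdempotent c) : J.IsIdempotent (J.unit - c) := by
  have hc' : J.jmul c c = c := hc
  simp [IsIdempotent, J.unit_jmul, J.jmul_unit, hc']

/-- The Peirce spaces of `c` for the eigenvalues `1` and `0` annihilate each other. -/
theorem jmul_eq_zero_of_complementary (hc : J.IsIdempotent c) {y w : E}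
    (hy : J.jmul (J.unit - c) y = 0) (hw : J.jmul c w = 0) : J.jmul y w = 0 := by
  have h₁ := hc.jmul_comm_of_jmul_eq_zero hw y
  have h₂ := hc.unit_sub.jmul_comm_of_jmul_eq_zero hy w
  simp only [map_sub, LinearMap.sub_apply, J.unit_jmul, hw, sub_zero] at hy h₂
  rw [← sub_eq_zero.mp hy, J.comm w y] at h₁
  rw [h₁]
  exact sub_eq_self.mp h₂.symm

end IsIdempotent

/-- If `w ↦ ⟪w ∘ w, lam⟫` is positive on the nonzero elements annihilating `y`, and `lam`
annihilates `y`, then everything annihilating `y` annihilates `y ∘ y`. -/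
theorem jmul_sq_eq_zero (J : EJA E) {y lam : E} (hlam : J.jmul y lam = 0)
    (hpos : ∀ w : E, J.jmul y w = 0 → w ≠ 0 → 0 < ⟪J.jmul w w, lam⟫)
    {w : E} (hw : J.jmul y w = 0) : J.jmul (J.jmul y y) w = 0 := by
  by_contra hne
  have hTw : J.jmul y (J.jmul (J.jmul y y) w) = 0 := by rw [J.jordan, hw, map_zero]
  have key : ∀ v : E, J.jmul y v = 0 → ⟪J.jmul (J.jmul (J.jmul y y) w) v, lam⟫ = 0 := by
    intro v hv
    have h := J.jmul_jmul_comm_of_jmul_eq_zero hv hlam y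
    rw [J.assoc_inner, J.inner_jmul_left, J.comm (J.jmul y y), ← h, ← J.inner_jmul_left, hw,
      inner_zero_left]
  exact (hpos _ hTw hne).ne' (key _ hTw)

namespace IsJordanFrame

variable {J : EJA E} {c : Fin J.rank → E}

theorem isIdempotent (hc : J.IsJordanFrame c) (i : Fin J.rank) : J.IsIdempotent (c i) :=
  (hc.1 i).1

theorem jmul_eq_ite (hc : J.IsJordanFrame c) (i j : Fin J.rank) :
    J.jmul (c i) (c j) = if i = j then c i else 0 := by
  split_ifs with hij
  · subst hij
    exact hc.isIdempotent i
  · exact hc.2.1 i j hij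

theorem sum_jmul_sum (hc : J.IsJordanFrame c) (σ τ : Fin J.rank → ℝ) :
    J.jmul (∑ i, σ i • c i) (∑ i, τ i • c i) = ∑ i, (σ i * τ i) • c i := by
  simp [map_sum, LinearMap.sum_apply, hc.jmul_eq_ite, smul_smul, mul_comm]

theorem inner_unit (hc : J.IsJordanFrame c) (i : Fin J.rank) : ⟪c i, J.unit⟫ = 1 := by
  have hi : J.jmul (c i) (c i) = c i := hc.isIdempotent i
  rw [← hi, J.assoc_inner, J.jmul_unit]
  exact J.inner_primitive (c i) hi (hc.1 i).2.1 (hc.1 i).2.2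

theorem inner_sum_smul (hc : J.IsJordanFrame c) (σ : Fin J.rank → ℝ) (i : Fin J.rank) :
    ⟪c i, ∑ j, σ j • c j⟫ = σ i := by
  rw [inner_sum]
  have : ∀ j, ⟪c i, σ j • c j⟫ = if i = j then σ j else 0 := by
    intro j
    rw [inner_smul_right]
    conv_lhs => rw [← J.jmul_unit (c j), ← J.assoc_inner, hc.jmul_eq_ite]
    split_ifs <;> simp [hc.inner_unit]
  simp [this]

/-- The idempotent projecting onto the nonzero part of the spectrum. -/
def support (c : Fin J.rank → E) (σ : Fin J.rank → ℝ) : E :=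
  ∑ i, (if σ i ≠ 0 then (1 : ℝ) else 0) • c i

theorem isIdempotent_support (hc : J.IsJordanFrame c) (σ : Fin J.rank → ℝ) :
    J.IsIdempotent (support c σ) := by
  rw [IsIdempotent, support, hc.sum_jmul_sum]
  simp only [mul_ite, mul_one, mul_zero, ← ite_and, and_self]

theorem support_jmul (hc : J.IsJordanFrame c) (σ : Fin J.rank → ℝ) :
    J.jmul (support c σ) (∑ i, σ i • c i) = ∑ i, σ i • c i := by
  rw [support, hc.sum_jmul_sum]
  refine Finset.sum_congr rfl fun i _ => ?_
  by_cases hi : σ i = 0 <;> simp [hi]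

theorem inner_support_unit (hc : J.IsJordanFrame c) (σ : Fin J.rank → ℝ) :
    ⟪support c σ, J.unit⟫ = ((Finset.univ.filter fun i => σ i ≠ 0).card : ℝ) := by
  simp only [support, sum_inner, real_inner_smul_left, hc.inner_unit, mul_one, Finset.sum_boole]

theorem inner_unit_unit (hc : J.IsJordanFrame c) : ⟪J.unit, J.unit⟫ = (J.rank : ℝ) := by
  calc ⟪J.unit, J.unit⟫ = ⟪∑ i, c i, J.unit⟫ := by rw [hc.2.2]
    _ = J.rank := by simp [sum_inner, hc.inner_unit]

theorem jmul_support_eq_zero {σ : Fin J.rank → ℝ} {a : E}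
    (h : ∀ i, σ i ≠ 0 → J.jmul a (c i) = 0) : J.jmul a (support c σ) = 0 := by
  rw [support, map_sum]
  refine Finset.sum_eq_zero fun i _ => ?_
  by_cases hi : σ i = 0 <;> simp [hi, h i]

/-- If `y ∘ y` is diagonal in a frame, an element is annihilated by `y ∘ y` only if it is
annihilated by the support idempotent. -/
theorem support_jmul_eq_zero (hc : J.IsJordanFrame c) {σ : Fin J.rank → ℝ} {y w : E}
    (hy : J.jmul y y = ∑ i, σ i • c i) (hw : J.jmul (J.jmul y y) w = 0) :
    J.jmul (support c σ) w = 0 := by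
  have hσ : ∀ i, 0 ≤ σ i := fun i => by
    rw [← hc.inner_sum_smul σ i, ← hy]
    exact (hc.isIdempotent i).inner_jmul_self_nonneg y
  have hsum : ∑ i, σ i * ⟪c i, J.jmul w w⟫ = 0 := by
    simp_rw [← real_inner_smul_left]
    rw [← sum_inner, ← hy, ← J.assoc_inner, hw, inner_zero_left]
  rw [Finset.sum_eq_zero_iff_of_nonneg fun i _ =>
    mul_nonneg (hσ i) ((hc.isIdempotent i).inner_jmul_self_nonneg w)] at hsum
  rw [J.comm]
  refine jmul_support_eq_zero fun i hi => ?_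
  rw [J.comm]
  exact (hc.isIdempotent i).jmul_eq_zero_of_inner_jmul_self
    ((mul_eq_zero.mp (hsum i (Finset.mem_univ i))).resolve_left hi)

/-- The support idempotent of `y ∘ y` fixes `y`. -/
theorem unit_sub_support_jmul (hc : J.IsJordanFrame c) {σ : Fin J.rank → ℝ} {y : E}
    (hy : J.jmul y y = ∑ i, σ i • c i) : J.jmul (J.unit - support c σ) y = 0 := by
  refine (hc.isIdempotent_support σ).unit_sub.jmul_eq_zero_of_inner_jmul_self ?_
  have h : J.jmul (J.unit - support c σ) (J.jmul y y) = 0 := by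
    rw [hy, map_sub, LinearMap.sub_apply, J.unit_jmul, hc.support_jmul, sub_self]
  rw [← J.jmul_unit (J.jmul y y), ← J.assoc_inner, h, inner_zero_left]

/-- If an idempotent annihilates an element, it annihilates its spectral idempotents belonging
to nonzero eigenvalues. -/
theorem jmul_eq_zero_of_jmul_sum_eq_zero (hc : J.IsJordanFrame c) {σ : Fin J.rank → ℝ} {p : E}
    (hp : J.IsIdempotent p) (h : J.jmul p (∑ i, σ i • c i) = 0) {i : Fin J.rank}
    (hi : σ i ≠ 0) : J.jmul p (c i) = 0 := by
  have hsum : ∑ j, (σ j * σ j) * ⟪p, J.jmul (c j) (c j)⟫ = 0 := by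
    have hsq : ⟪p, J.jmul (∑ j, σ j • c j) (∑ j, σ j • c j)⟫ = 0 := by
      rw [← J.assoc_inner, h, inner_zero_left]
    rw [hc.sum_jmul_sum, inner_sum] at hsq
    simpa [inner_smul_right, hc.jmul_eq_ite] using hsq
  rw [Finset.sum_eq_zero_iff_of_nonneg fun j _ =>
    mul_nonneg (mul_self_nonneg _) (hp.inner_jmul_self_nonneg (c j))] at hsum
  exact hp.jmul_eq_zero_of_inner_jmul_self
    ((mul_eq_zero.mp (hsum i (Finset.mem_univ i))).resolve_left (mul_self_ne_zero.mpr hi))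

theorem sum_smul_mem_K (hc : J.IsJordanFrame c) {σ : Fin J.rank → ℝ} (hσ : ∀ i, 0 ≤ σ i) :
    ∑ i, σ i • c i ∈ J.K :=
  ⟨∑ i, √(σ i) • c i, by simp only [hc.sum_jmul_sum, Real.mul_self_sqrt (hσ _)]⟩

end IsJordanFrame

theorem exists_isJordanFrame (J : EJA E) (y : E) :
    ∃ (c : Fin J.rank → E) (σ : Fin J.rank → ℝ),
      J.IsJordanFrame c ∧ y = ∑ i, σ i • c i := by
  obtain ⟨c, σ, hid, hne, hprim, hort, hsum, hy⟩ := J.spectral y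
  exact ⟨c, σ, ⟨fun i => ⟨hid i, hne i, hprim i⟩, hort, hsum⟩, hy⟩

section SecondOrder

open IsJordanFrame

variable {J : EJA E} {y lam : E} {c d : Fin J.rank → E} {τ σ : Fin J.rank → ℝ}

theorem support_jmul_spectral_eq_zero (hlam : J.jmul y lam = 0)
    (hpos : ∀ w : E, J.jmul y w = 0 → w ≠ 0 → 0 < ⟪J.jmul w w, lam⟫)
    (hc : J.IsJordanFrame c) (hy : J.jmul y y = ∑ i, τ i • c i)
    (hd : J.IsJordanFrame d) (hl : lam = ∑ i, σ i • d i) {i : Fin J.rank} (hi : σ i ≠ 0) :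
    J.jmul (support c τ) (d i) = 0 :=
  hd.jmul_eq_zero_of_jmul_sum_eq_zero (hc.isIdempotent_support τ)
    (hl ▸ hc.support_jmul_eq_zero hy (J.jmul_sq_eq_zero hlam hpos hlam)) hi

theorem mem_K_of_pos (hlam : J.jmul y lam = 0)
    (hpos : ∀ w : E, J.jmul y w = 0 → w ≠ 0 → 0 < ⟪J.jmul w w, lam⟫) : lam ∈ J.K := by
  obtain ⟨c, τ, hc, hy⟩ := J.exists_isJordanFrame (J.jmul y y)
  obtain ⟨d, σ, hd, hl⟩ := J.exists_isJordanFrame lam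
  have hσ : ∀ i, 0 ≤ σ i := by
    intro i
    by_cases hi : σ i = 0
    · exact hi.ge
    have hyd : J.jmul y (d i) = 0 :=
      (hc.isIdempotent_support τ).jmul_eq_zero_of_complementary (hc.unit_sub_support_jmul hy)
        (support_jmul_spectral_eq_zero hlam hpos hc hy hd hl hi)
    have h := hpos (d i) hyd (hd.1 i).2.1
    have hid : J.jmul (d i) (d i) = d i := hd.isIdempotent i
    rw [hid, hl, hd.inner_sum_smul] at h
    exact h.le
  rw [hl]
  exact hd.sum_smul_mem_K hσ

theorem hasRank_add_hasRank_of_pos (hlam : J.jmul y lam = 0)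
    (hpos : ∀ w : E, J.jmul y w = 0 → w ≠ 0 → 0 < ⟪J.jmul w w, lam⟫) {k l : ℕ}
    (hk : J.HasRank (J.jmul y y) k) (hl : J.HasRank lam l) : k + l = J.rank := by
  obtain ⟨c, τ, hc, hy, rfl⟩ := hk
  obtain ⟨d, σ, hd, hlam', rfl⟩ := hl
  have hid : J.jmul (support c τ) (support c τ) = support c τ := hc.isIdempotent_support τ
  have hcd : J.jmul (support c τ) (support d σ) = 0 :=
    jmul_support_eq_zero fun i hi => support_jmul_spectral_eq_zero hlam hpos hc hy hd hlam' hi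
  have hclam : J.jmul (support c τ) lam = 0 :=
    hc.support_jmul_eq_zero hy (J.jmul_sq_eq_zero hlam hpos hlam)
  have hdlam : J.jmul (support d σ) lam = lam := by
    rw [hlam']
    exact hd.support_jmul σ
  have hw : J.unit - support c τ - support d σ = 0 := by
    by_contra hne
    refine (hpos _ ((hc.isIdempotent_support τ).jmul_eq_zero_of_complementary
      (hc.unit_sub_support_jmul hy) ?_) hne).ne' ?_
    · simp [J.jmul_unit, hid, hcd]
    · rw [J.assoc_inner]
      simp [J.unit_jmul, hclam, hdlam]
  have htr := congrArg (fun u => ⟪u, J.unit⟫) hw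
  simp only [inner_sub_left, inner_zero_left, hc.inner_unit_unit, hc.inner_support_unit,
    hd.inner_support_unit] at htr
  have : ((Finset.univ.filter fun i => τ i ≠ 0).card : ℝ) +
      (Finset.univ.filter fun i => σ i ≠ 0).card = J.rank := by linarith
  exact_mod_cast this

end SecondOrder

end EJA

/-- a KKT quadruple of (P2) with the positivity condition of
Theorem `strict` yields a KKT triple of (P1) satisfying strict
complementarity. -/
theorem stmt9 {E : Type*} [NormedAddCommGroup E] [InnerProductSpace ℝ E]
    [FiniteDimensional ℝ E] (J : EJA E) {n m : ℕ}
    (f : EuclideanSpace ℝ (Fin n) → ℝ)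
    (h : EuclideanSpace ℝ (Fin n) → EuclideanSpace ℝ (Fin m))
    (g : EuclideanSpace ℝ (Fin n) → E)
    (hf : ContDiff ℝ 2 f) (hh : ContDiff ℝ 2 h) (hg : ContDiff ℝ 2 g)
    (x : EuclideanSpace ℝ (Fin n)) (y : E)
    (μ : EuclideanSpace ℝ (Fin m)) (lam : E)
    (hKKT : J.KKTP2 f h g x y μ lam)
    (hpos : ∀ w : E, J.jmul y w = 0 → w ≠ 0 → 0 < ⟪J.jmul w w, lam⟫) :
    J.KKTP1 f h g x μ lam ∧
      ∀ kg kl : ℕ, J.HasRank (g x) kg → J.HasRank lam kl →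
        kg + kl = J.rank := by
  obtain ⟨hgrad, hly, hgx, hhx⟩ := hKKT
  have hyl : J.jmul y lam = 0 := by rw [J.comm, hly]
  refine ⟨⟨hgrad, EJA.mem_K_of_pos hyl hpos, ⟨y, hgx⟩, ?_, hhx⟩, fun kg kl hkg hkl => ?_⟩
  · rw [hgx, J.comm]
    exact J.jmul_sq_eq_zero hyl hpos hyl
  · rw [hgx] at hkg
    exact EJA.hasRank_add_hasRank_of_pos hyl hpos hkg hkl
end
end
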